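/- arXiv:1910.11962 — 2 statements merged into one kernel-verified Lean document; each statement's English description precedes it below -/
import Mathlib

section
/- Let X be a real Banach space and let A ⊆ B_X be nonempty and non-ε-dentable. Then A contains a countable subset A₀ ⊆ A that is non-(ε/2)-dentable. More precisely, there exists a countable A₀ ⊆ A such that for every a ∈ A₀, a ∈ cl(co(A₀ \ B̄_{ε/2}(a))); hence every slice S of A₀ satisfies diam(S) > ε/2. -/
open Set Metric Bornology Pointwise

variable {X : Type*} [NormedAddCommGroup X] [NormedSpace ℝ X]

/-- The slice `S(f, A, δ) = {a ∈ A : f a > sup f(A) - δ}`. -/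
noncomputable def sliceSet (f : X →L[ℝ] ℝ) (A : Set X) (δ : ℝ) : Set X :=
  {a ∈ A | sSup (f '' A) - δ < f a}

/-- `S` is a slice of `A`: `S = S(f, A, δ)` for some `f` in the closed unit ball
of the dual and some `δ > 0`. -/
def IsSlice (A S : Set X) : Prop :=
  ∃ (f : X →L[ℝ] ℝ) (δ : ℝ), ‖f‖ ≤ 1 ∧ 0 < δ ∧ S = sliceSet f A δ

/-- A bounded set `A` is `ε`-dentable if it has a slice of diameter at most `ε`. -/
def EpsDentable (ε : ℝ) (A : Set X) : Prop :=
  ∃ S, IsSlice A S ∧ Metric.diam S ≤ ε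

/-- A point in the closed convex hull of a set lies in the closed convex hull of one of its
countable subsets. -/
theorem exists_countable_subset_mem_closure_convexHull {E : Set X} {a : X}
    (ha : a ∈ closure (convexHull ℝ E)) :
    ∃ C ⊆ E, C.Countable ∧ a ∈ closure (convexHull ℝ C) := by
  obtain ⟨x, hx, hxa⟩ := mem_closure_iff_seq_limit.1 ha
  have hfin : ∀ n, ∃ t : Finset X, (t : Set X) ⊆ E ∧ x n ∈ convexHull ℝ (t : Set X) := by
    intro n
    have h := hx n
    rw [convexHull_eq_union_convexHull_finite_subsets] at h
    simpa using h
  choose t htE hxt using hfin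
  refine ⟨⋃ n, (t n : Set X), iUnion_subset htE,
    countable_iUnion fun n => (t n).countable_toSet, ?_⟩
  exact mem_closure_of_tendsto hxa <| Filter.Eventually.of_forall fun n =>
    convexHull_mono (subset_iUnion (fun n => (t n : Set X)) n) (hxt n)

/-- If `C` maps points of `A` to countable subsets of `A`, then every point of `A` lies in a
countable subset of `A` that is closed under `C`. -/
theorem exists_countable_superset_closed {α : Type*} {A : Set α} {C : α → Set α}
    (hCA : ∀ a ∈ A, C a ⊆ A) (hC : ∀ a ∈ A, (C a).Countable) {a₀ : α} (ha₀ : a₀ ∈ A) :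
    ∃ B ⊆ A, B.Countable ∧ a₀ ∈ B ∧ ∀ a ∈ B, C a ⊆ B := by
  let T : ℕ → Set α := fun n => Nat.rec {a₀} (fun _ s => ⋃ a ∈ s, C a) n
  have hT : ∀ n, T n ⊆ A ∧ (T n).Countable := by
    intro n
    induction n with
    | zero => exact ⟨singleton_subset_iff.2 ha₀, countable_singleton a₀⟩
    | succ n ih =>
      exact ⟨iUnion₂_subset fun a ha => hCA a (ih.1 ha),
        ih.2.biUnion fun a ha => hC a (ih.1 ha)⟩
  refine ⟨⋃ n, T n, iUnion_subset fun n => (hT n).1, countable_iUnion fun n => (hT n).2,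
    mem_iUnion.2 ⟨0, mem_singleton a₀⟩, fun a ha => ?_⟩
  obtain ⟨n, hn⟩ := mem_iUnion.1 ha
  exact fun y hy => mem_iUnion.2 ⟨n + 1, mem_biUnion hn hy⟩

theorem bddAbove_image_of_isBounded {A : Set X} (hA : IsBounded A) (f : X →L[ℝ] ℝ) :
    BddAbove (f '' A) :=
  (f.lipschitz.isBounded_image hA).bddAbove

/-- If removing the closed ball of radius `ε / 2` around a point of `A` removes that point from the
closed convex hull, then `A` is `ε`-dentable. -/
theorem epsDentable_of_notMem_closure_convexHull {A : Set X} (hA : IsBounded A) {ε : ℝ}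
    (hε : 0 ≤ ε) {a : X} (ha : a ∈ A)
    (h : a ∉ closure (convexHull ℝ (A \ closedBall a (ε / 2)))) : EpsDentable ε A := by
  obtain ⟨f, u, hfu, hua⟩ := geometric_hahn_banach_closed_point
    (convex_convexHull ℝ (A \ closedBall a (ε / 2))).closure isClosed_closure h
  have hc : 0 < (‖f‖ + 1)⁻¹ := by positivity
  set c := (‖f‖ + 1)⁻¹ with hcdef
  have hsup : c * f a ≤ sSup ((c • f) '' A) :=
    le_csSup (bddAbove_image_of_isBounded hA (c • f)) ⟨a, ha, rfl⟩
  refine ⟨_, ⟨c • f, sSup ((c • f) '' A) - c * u, ?_, ?_, rfl⟩, ?_⟩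
  · rw [norm_smul, Real.norm_of_nonneg hc.le, hcdef, inv_mul_le_iff₀ (by positivity)]
    linarith
  · linarith [mul_lt_mul_of_pos_left hua hc]
  · have hsub : sliceSet (c • f) A (sSup ((c • f) '' A) - c * u) ⊆ closedBall a (ε / 2) := by
      rintro x ⟨hxA, hx⟩
      by_contra hxb
      have h1 := hfu x (subset_closure (subset_convexHull ℝ _ ⟨hxA, hxb⟩))
      have h2 : c * u < c * f x := by simpa using hx
      exact (lt_of_mul_lt_mul_left h2 hc.le).not_gt h1
    calc diam _ ≤ diam (closedBall a (ε / 2)) := diam_mono hsub isBounded_closedBall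
      _ ≤ 2 * (ε / 2) := diam_closedBall (by positivity)
      _ = ε := by ring

/-- If every point of `A` lies in the closed convex hull of the points of `A` at distance more than
`r`, then every slice of `A` has diameter more than `r`. -/
theorem lt_diam_of_isSlice {A : Set X} (hA : IsBounded A) (hne : A.Nonempty) {r : ℝ}
    (h : ∀ a ∈ A, a ∈ closure (convexHull ℝ (A \ closedBall a r))) {S : Set X}
    (hS : IsSlice A S) : r < diam S := by
  obtain ⟨f, δ, -, hδ, rfl⟩ := hS
  obtain ⟨_, ⟨a, haA, rfl⟩, ha⟩ :=
    exists_lt_of_lt_csSup (hne.image f) (sub_lt_self (sSup (f '' A)) hδ)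
  by_contra! hr
  have hsub : A \ closedBall a r ⊆ {x | f x ≤ sSup (f '' A) - δ} := by
    rintro x ⟨hxA, hxb⟩
    by_contra hx
    have hdist := dist_le_diam_of_mem (hA.subset (sep_subset A _))
      (show x ∈ sliceSet f A δ from ⟨hxA, not_le.1 hx⟩) ⟨haA, ha⟩
    exact hxb (hdist.trans hr)
  have hle : f a ≤ sSup (f '' A) - δ :=
    closure_minimal (convexHull_min hsub (convex_halfSpace_le f.isLinear _))
      (isClosed_le f.continuous continuous_const) (h a haA)
  exact hle.not_gt ha

theorem statement9 [CompleteSpace X] (A : Set X)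
    (hA1 : A ⊆ Metric.closedBall (0 : X) 1) (hAne : A.Nonempty)
    (ε : ℝ) (hε : 0 < ε) (hAnd : ¬ EpsDentable ε A) :
    ∃ A₀ : Set X, A₀ ⊆ A ∧ A₀.Countable ∧
      ¬ EpsDentable (ε / 2) A₀ ∧
      (∀ a ∈ A₀, a ∈ closure (convexHull ℝ (A₀ \ Metric.closedBall a (ε / 2)))) ∧
      (∀ S, IsSlice A₀ S → ε / 2 < Metric.diam S) := by
  have hbdd : IsBounded A := isBounded_closedBall.subset hA1
  have hex : ∀ a, ∃ C : Set X, a ∈ A → C ⊆ A \ closedBall a (ε / 2) ∧ C.Countable ∧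
      a ∈ closure (convexHull ℝ C) := by
    intro a
    by_cases ha : a ∈ A
    · obtain ⟨C, hC⟩ := exists_countable_subset_mem_closure_convexHull <| not_not.1 fun h =>
        hAnd (epsDentable_of_notMem_closure_convexHull hbdd hε.le ha h)
      exact ⟨C, fun _ => hC⟩
    · exact ⟨∅, fun h => absurd h ha⟩
  choose C hC using hex
  obtain ⟨a₀, ha₀⟩ := hAne
  obtain ⟨B, hBA, hBc, haB, hB⟩ := exists_countable_superset_closed (C := C)
    (fun a ha => (hC a ha).1.trans sdiff_subset) (fun a ha => (hC a ha).2.1) ha₀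
  have hmem : ∀ a ∈ B, a ∈ closure (convexHull ℝ (B \ closedBall a (ε / 2))) := by
    intro a ha
    obtain ⟨hCa, -, haC⟩ := hC a (hBA ha)
    have hsub : C a ⊆ B \ closedBall a (ε / 2) := fun x hx => ⟨hB a ha hx, (hCa hx).2⟩
    exact closure_mono (convexHull_mono hsub) haC
  have hslice : ∀ S, IsSlice B S → ε / 2 < diam S := fun S =>
    lt_diam_of_isSlice (hbdd.subset hBA) ⟨a₀, haB⟩ hmem
  exact ⟨B, hBA, hBc, fun ⟨S, hS, hd⟩ => (hslice S hS).not_ge hd, hmem, hslice⟩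
end

section
/- Let X be a real Banach space and let A ⊆ B_X be nonempty, separable, and non-ε-dentable. Then for every δ < ε/2 and every positive sequence (δₙ)ₙ≥₀, there exists a δ-separated (δₙ)ₙ≥₀-approximate bush (x_b)_{b∈𝕋} contained in A (with 𝕋 a finitely branching tree) such that any family (y_b)_{b∈𝕋} ⊆ cl(co(A)) satisfying sup_{b∈𝕋ₙ} ‖y_b − x_b‖ < γₙ for some sequence γₙ → 0 is weakly closed and weakly discrete. In particular, (x_b)_{b∈𝕋} itself is weakly closed and weakly discrete. -/
open Set Metric Bornology Pointwise

variable {X : Type*} [NormedAddCommGroup X] [NormedSpace ℝ X]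

/-- A tree: a nonempty set of finite sequences of naturals closed under dropping
the last entry. -/
def IsTree (T : Set (List ℕ)) : Prop :=
  T.Nonempty ∧ ∀ (b : List ℕ) (i : ℕ), b ++ [i] ∈ T → b ∈ T

/-- A tree is finitely branching if every node has finitely many children. -/
def FinitelyBranching (T : Set (List ℕ)) : Prop :=
  ∀ b ∈ T, {i : ℕ | b ++ [i] ∈ T}.Finite

/-- A set is weakly closed if it is closed in the weak topology of `X`. -/
def WeaklyClosed (F : Set X) : Prop :=
  IsClosed (⇑(toWeakSpace ℝ X) '' F : Set (WeakSpace ℝ X))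

/-- A set is weakly discrete if it is discrete in the weak topology of `X`. -/
def WeaklyDiscrete (F : Set X) : Prop :=
  DiscreteTopology (⇑(toWeakSpace ℝ X) '' F : Set (WeakSpace ℝ X))

/-- Points of the convex hull of `C ∪ D` at which a functional is close to its upper bound are
close to the convex set `C`, provided the functional is bounded away from this bound on `D`. -/
theorem exists_norm_sub_le_of_mem_convexHull_union {C D : Set X} (hC : Convex ℝ C)
    (hCne : C.Nonempty) {f : X →L[ℝ] ℝ} {m M : ℝ} (hmM : m < M) (hfC : ∀ z ∈ C, f z ≤ M)
    (hfD : ∀ z ∈ D, f z ≤ m) (hC1 : C ⊆ closedBall 0 1) (hD1 : D ⊆ closedBall 0 1)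
    {z : X} (hz : z ∈ convexHull ℝ (C ∪ D)) :
    ∃ c ∈ C, ‖z - c‖ ≤ 2 * (M - f z) / (M - m) := by
  have hpos : 0 < M - m := sub_pos.2 hmM
  have hconv : Convex ℝ {z : X | ∃ c ∈ C, ‖z - c‖ ≤ 2 * (M - f z) / (M - m)} := by
    rintro u ⟨c, hc, hcu⟩ v ⟨d, hd, hdv⟩ a b ha hb hab
    refine ⟨a • c + b • d, hC hc hd ha hb hab, ?_⟩
    calc ‖a • u + b • v - (a • c + b • d)‖ = ‖a • (u - c) + b • (v - d)‖ := by
          congr 1; module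
      _ ≤ ‖a • (u - c)‖ + ‖b • (v - d)‖ := norm_add_le _ _
      _ = a * ‖u - c‖ + b * ‖v - d‖ := by
          rw [norm_smul, norm_smul, Real.norm_of_nonneg ha, Real.norm_of_nonneg hb]
      _ ≤ a * (2 * (M - f u) / (M - m)) + b * (2 * (M - f v) / (M - m)) := by gcongr
      _ = 2 * (M - f (a • u + b • v)) / (M - m) := by
          simp only [map_add, map_smul, smul_eq_mul]
          obtain rfl : b = 1 - a := by linarith
          field_simp
          ring
  refine convexHull_min ?_ hconv hz
  rintro w (hw | hw)
  · refine ⟨w, hw, ?_⟩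
    have := hfC w hw
    rw [sub_self, norm_zero]
    exact div_nonneg (by linarith) hpos.le
  · obtain ⟨c, hc⟩ := hCne
    refine ⟨c, hc, ?_⟩
    have h1 := mem_closedBall_zero_iff.1 (hC1 hc)
    have h2 := mem_closedBall_zero_iff.1 (hD1 hw)
    have h3 := hfD w hw
    rw [le_div_iff₀ hpos]
    nlinarith [norm_sub_le w c]

theorem exists_norm_sub_lt_of_mem_closure_convexHull_union {C D : Set X} (hC : Convex ℝ C)
    (hCne : C.Nonempty) {f : X →L[ℝ] ℝ} {m M : ℝ} (hmM : m < M) (hfC : ∀ z ∈ C, f z ≤ M)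
    (hfD : ∀ z ∈ D, f z ≤ m) (hC1 : C ⊆ closedBall 0 1) (hD1 : D ⊆ closedBall 0 1)
    {z : X} (hz : z ∈ closure (convexHull ℝ (C ∪ D))) {t : ℝ}
    (ht : 2 * (M - f z) / (M - m) < t) : ∃ c ∈ C, ‖z - c‖ < t := by
  have hopen : IsOpen {w : X | ‖z - w‖ + 2 * (M - f w) / (M - m) < t} :=
    isOpen_lt (by fun_prop) continuous_const
  obtain ⟨w, hw, hwz⟩ := mem_closure_iff.1 hz _ hopen (by simpa using ht)
  obtain ⟨c, hc, hcw⟩ :=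
    exists_norm_sub_le_of_mem_convexHull_union hC hCne hmM hfC hfD hC1 hD1 hwz
  refine ⟨c, hc, ?_⟩
  have := norm_sub_le_norm_sub_add_norm_sub z w c
  simp only [mem_ofPred_eq] at hw
  linarith

theorem forall_mem_closure_convexHull_le {A : Set X} {f : X →L[ℝ] ℝ} {M : ℝ}
    (h : ∀ a ∈ A, f a ≤ M) : ∀ z ∈ closure (convexHull ℝ A), f z ≤ M :=
  closure_minimal (convexHull_min h (convex_halfSpace_le f.isLinear M))
    (isClosed_le f.continuous continuous_const)

theorem closure_convexHull_subset {A K : Set X} (hK : Convex ℝ K) (hKc : IsClosed K)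
    (h : A ⊆ K) : closure (convexHull ℝ A) ⊆ K :=
  closure_minimal (convexHull_min h hK) hKc

theorem bddAbove_image_of_subset_closedBall {A : Set X} (hA1 : A ⊆ closedBall 0 1)
    (f : X →L[ℝ] ℝ) : BddAbove (f '' A) := by
  refine ⟨‖f‖, ?_⟩
  rintro _ ⟨a, ha, rfl⟩
  have := mem_closedBall_zero_iff.1 (hA1 ha)
  calc f a ≤ ‖f a‖ := le_abs_self _
    _ ≤ ‖f‖ * ‖a‖ := f.le_opNorm a
    _ ≤ ‖f‖ * 1 := by gcongr
    _ = ‖f‖ := mul_one _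

/-- Nonempty intersections of `A` with open half-spaces are slices, without normalisation. -/
theorem lt_diam_of_not_epsDentable {A : Set X} {ε : ℝ} (hA : ¬ EpsDentable ε A)
    (hA1 : A ⊆ closedBall 0 1) (f : X →L[ℝ] ℝ) {s : ℝ} (hs : ∃ a ∈ A, s < f a) :
    ε < Metric.diam {a ∈ A | s < f a} := by
  by_contra! h
  refine hA ⟨_, ?_, h⟩
  obtain ⟨a, ha, has⟩ := hs
  have hM : s < sSup (f '' A) :=
    has.trans_le (le_csSup (bddAbove_image_of_subset_closedBall hA1 f) ⟨a, ha, rfl⟩)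
  have hc : 0 < ‖f‖ + 1 := by positivity
  refine ⟨(‖f‖ + 1)⁻¹ • f, (‖f‖ + 1)⁻¹ * (sSup (f '' A) - s), ?_,
    mul_pos (inv_pos.2 hc) (sub_pos.2 hM), ?_⟩
  · rw [norm_smul, norm_inv, Real.norm_of_nonneg hc.le, inv_mul_le_iff₀ hc]
    linarith
  · have hsup : sSup (((‖f‖ + 1)⁻¹ • f) '' A) = (‖f‖ + 1)⁻¹ * sSup (f '' A) := by
      rw [← smul_eq_mul, ← Real.sSup_smul_of_nonneg (inv_nonneg.2 hc.le)]
      congr 1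
      ext z
      simp [mem_smul_set]
    ext z
    rw [sliceSet, hsup, ← mul_sub, sub_sub_cancel]
    exact and_congr_right fun _ => (mul_lt_mul_iff_right₀ (inv_pos.2 hc)).symm

/-- A version of the superlemma for a single small convex set. -/
theorem subset_of_subset_closure_convexHull_union {A C D : Set X} {ε r : ℝ}
    (hA : ¬ EpsDentable ε A) (hA1 : A ⊆ closedBall 0 1) (hr : 0 ≤ r) (hrε : r < ε / 2)
    (hD : Convex ℝ D) (hDc : IsClosed D) (hD1 : D ⊆ closedBall 0 1) (hC : Convex ℝ C)
    (hCA : C ⊆ closure (convexHull ℝ A)) {p : X} (hCp : C ⊆ closedBall p r)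
    (h : A ⊆ closure (convexHull ℝ (C ∪ D))) : A ⊆ D := by
  intro a ha
  by_contra haD
  obtain ⟨f, u, hfD, hua⟩ := geometric_hahn_banach_closed_point hD hDc haD
  have hCne : C.Nonempty := by
    by_contra hne
    rw [not_nonempty_iff_eq_empty] at hne
    subst hne
    rw [empty_union, hD.convexHull_eq, hDc.closure_eq] at h
    exact haD (h ha)
  have hbdd := bddAbove_image_of_subset_closedBall hA1 f
  set M := sSup (f '' A)
  have hfM : ∀ z ∈ A, f z ≤ M := fun z hz => le_csSup hbdd ⟨z, hz, rfl⟩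
  have huM : u < M := hua.trans_le (hfM a ha)
  set t := ε / 2 - r with ht_def
  have ht : 0 < t := sub_pos.2 hrε
  have hpos : 0 < M - u := sub_pos.2 huM
  obtain ⟨_, ⟨b, hb, rfl⟩, hbM⟩ := exists_lt_of_lt_csSup (⟨_, a, ha, rfl⟩ : (f '' A).Nonempty)
    (show M - t / 2 * (M - u) < sSup (f '' A) from sub_lt_self M (by positivity))
  refine (lt_diam_of_not_epsDentable hA hA1 f ⟨b, hb, hbM⟩).not_ge ?_
  have hnear : ∀ z ∈ {a ∈ A | M - t / 2 * (M - u) < f a}, dist z p ≤ r + t := by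
    rintro z ⟨hzA, hz⟩
    obtain ⟨c, hc, hzc⟩ := exists_norm_sub_lt_of_mem_closure_convexHull_union hC hCne huM
      (fun z hz => forall_mem_closure_convexHull_le hfM z (hCA hz)) (fun z hz => (hfD z hz).le)
      (hCA.trans (closure_convexHull_subset (convex_closedBall 0 1) isClosed_closedBall hA1))
      hD1 (h hzA) (t := t) (by rw [div_lt_iff₀ hpos]; linarith)
    have hcp : dist c p ≤ r := hCp hc
    rw [← dist_eq_norm] at hzc
    linarith [dist_triangle z c p]
  refine Metric.diam_le_of_forall_dist_le (by linarith) fun z hz w hw => ?_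
  have h1 := hnear z hz
  have h2 := hnear w hw
  have h3 := dist_triangle_right z w p
  linarith

/-- A closed convex set which, together with finitely many small balls, generates the closed
convex hull of a non-dentable set contains this set. -/
theorem subset_of_subset_closure_convexHull_union_biUnion {A D : Set X} {ε r : ℝ}
    (hA : ¬ EpsDentable ε A) (hA1 : A ⊆ closedBall 0 1) (hr : 0 ≤ r) (hrε : r < ε / 2)
    (hD : Convex ℝ D) (hDc : IsClosed D) (hDA : D ⊆ closure (convexHull ℝ A)) (F : Finset X)
    (h : A ⊆ closure (convexHull ℝ
      ((closure (convexHull ℝ A) ∩ ⋃ p ∈ F, closedBall p r) ∪ D))) : A ⊆ D := by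
  classical
  have hK1 : closure (convexHull ℝ A) ⊆ closedBall 0 1 :=
    closure_convexHull_subset (convex_closedBall 0 1) isClosed_closedBall hA1
  have hK : Convex ℝ (closure (convexHull ℝ A)) := (convex_convexHull ℝ A).closure
  induction F using Finset.induction_on with
  | empty => simpa [hD.convexHull_eq, hDc.closure_eq] using h
  | insert p F _ ih =>
    refine ih (subset_of_subset_closure_convexHull_union (p := p)
      (C := closure (convexHull ℝ A) ∩ closedBall p r) hA hA1 hr hrε
      (convex_convexHull ℝ _).closure isClosed_closure ?_ (hK.inter (convex_closedBall p r))
      inter_subset_left inter_subset_right (h.trans (closure_mono (convexHull_mono ?_))))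
    · refine (closure_convexHull_subset hK isClosed_closure ?_).trans hK1
      exact union_subset inter_subset_left hDA
    · rw [Finset.set_biUnion_insert, inter_union_distrib_left, union_assoc]
      exact union_subset_union_right _ ((subset_convexHull ℝ _).trans subset_closure)

/-- The point `x` of `A` lies in the slice of `A` cut off by `f > s`, at relative depth at
least `1 - τ` with respect to the upper bound `M` of `f` on `A`. -/
structure IsDeepPoint (A : Set X) (τ : ℝ) (x : X) (f : X →L[ℝ] ℝ) (s M : ℝ) : Prop where
  mem : x ∈ A
  le : ∀ a ∈ A, f a ≤ M
  lt : s < f x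
  sub_lt : M - f x < τ * (M - s)

/-- The closed convex hull of `A` is generated by `{f ≤ s}` and the points lying deep inside slices
that avoid `{f ≤ s}` and finitely many small balls. -/
theorem subset_closure_convexHull_deepPoints {A : Set X} {ε r : ℝ}
    (hA : ¬ EpsDentable ε A) (hA1 : A ⊆ closedBall 0 1) (hr : 0 ≤ r) (hrε : r < ε / 2)
    (f : X →L[ℝ] ℝ) (s : ℝ) {τ : ℝ} (hτ : 0 < τ) (F : Finset X) :
    A ⊆ closure (convexHull ℝ ({a | ∃ g u N, IsDeepPoint A τ a g u N ∧
        (∀ z ∈ closure (convexHull ℝ A), f z ≤ s → g z < u) ∧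
        ∀ p ∈ F, ∀ z ∈ closure (convexHull ℝ A), z ∈ closedBall p r → g z < u} ∪
      {z ∈ closure (convexHull ℝ A) | f z ≤ s})) := by
  have hK : Convex ℝ (closure (convexHull ℝ A)) := (convex_convexHull ℝ A).closure
  set D := {a | ∃ g u N, IsDeepPoint A τ a g u N ∧
        (∀ z ∈ closure (convexHull ℝ A), f z ≤ s → g z < u) ∧
        ∀ p ∈ F, ∀ z ∈ closure (convexHull ℝ A), z ∈ closedBall p r → g z < u}
  set L := {z ∈ closure (convexHull ℝ A) | f z ≤ s}
  have hDA : D ⊆ A := by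
    rintro a ⟨g, u, N, h, -⟩
    exact h.mem
  refine subset_of_subset_closure_convexHull_union_biUnion hA hA1 hr hrε
    (convex_convexHull ℝ _).closure isClosed_closure
    (closure_convexHull_subset hK isClosed_closure (union_subset
      (hDA.trans ((subset_convexHull ℝ A).trans subset_closure)) (sep_subset _ _))) F ?_
  intro a ha
  by_contra hna
  obtain ⟨g, u, hg, hua⟩ :=
    geometric_hahn_banach_closed_point (convex_convexHull ℝ _).closure isClosed_closure hna
  replace hg := fun z hz => hg z (subset_closure (subset_convexHull ℝ _ hz))
  have hgL : ∀ z ∈ D ∪ L, g z < u :=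
    fun z hz => hg z (Or.inr (subset_closure (subset_convexHull ℝ _ hz)))
  have hbdd := bddAbove_image_of_subset_closedBall hA1 g
  have huM : u < sSup (g '' A) := hua.trans_le (le_csSup hbdd ⟨a, ha, rfl⟩)
  have hpos : 0 < sSup (g '' A) - u := sub_pos.2 huM
  have hlt : max u (sSup (g '' A) - τ * (sSup (g '' A) - u)) < sSup (g '' A) :=
    max_lt huM (by linarith [mul_pos hτ hpos])
  obtain ⟨_, ⟨b, hb, rfl⟩, hbM⟩ :=
    exists_lt_of_lt_csSup (⟨_, a, ha, rfl⟩ : (g '' A).Nonempty) hlt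
  obtain ⟨hb1, hb2⟩ := max_lt_iff.1 hbM
  refine (hgL b (Or.inl ⟨g, u, sSup (g '' A), ⟨hb, fun z hz => le_csSup hbdd ⟨z, hz, rfl⟩, hb1,
    by linarith⟩, fun z hz hzs => hgL z (Or.inr ⟨hz, hzs⟩), fun p hp z hz hzp => ?_⟩)).not_gt hb1
  exact hg z (Or.inl ⟨hz, mem_biUnion hp hzp⟩)

/-- A point deep inside a slice is approximated by convex combinations of finitely many points
lying deep inside smaller slices that avoid prescribed small balls. -/
theorem exists_finite_deepPoints {A : Set X} {ε r : ℝ}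
    (hA : ¬ EpsDentable ε A) (hA1 : A ⊆ closedBall 0 1) (hr : 0 ≤ r) (hrε : r < ε / 2)
    {x : X} {f : X →L[ℝ] ℝ} {s M τ τ' η : ℝ} (hx : IsDeepPoint A τ x f s M) (hτη : 2 * τ ≤ η)
    (hτ' : 0 < τ') (F : Finset X) :
    ∃ t : Set X, t.Finite ∧ (∃ d ∈ convexHull ℝ t, ‖x - d‖ < η) ∧ ∀ a ∈ t,
      ∃ g u N, IsDeepPoint A τ' a g u N ∧
        (∀ z ∈ closure (convexHull ℝ A), f z ≤ s → g z < u) ∧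
        ∀ p ∈ F, ∀ z ∈ closure (convexHull ℝ A), z ∈ closedBall p r → g z < u := by
  have hcover := subset_closure_convexHull_deepPoints hA hA1 hr hrε f s hτ' F
  set D := {a | ∃ g u N, IsDeepPoint A τ' a g u N ∧
        (∀ z ∈ closure (convexHull ℝ A), f z ≤ s → g z < u) ∧
        ∀ p ∈ F, ∀ z ∈ closure (convexHull ℝ A), z ∈ closedBall p r → g z < u}
  have hDA : D ⊆ A := by
    rintro a ⟨g, u, N, h, -⟩
    exact h.mem
  have hK1 : closure (convexHull ℝ A) ⊆ closedBall 0 1 :=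
    closure_convexHull_subset (convex_closedBall 0 1) isClosed_closedBall hA1
  have hDne : D.Nonempty := by
    by_contra hne
    rw [not_nonempty_iff_eq_empty] at hne
    rw [hne, empty_union] at hcover
    exact (forall_mem_closure_convexHull_le (f := f) (M := s) (fun z hz => hz.2) x
      (hcover hx.mem)).not_gt hx.lt
  have hsM : s < M := hx.lt.trans_le (hx.le x hx.mem)
  obtain ⟨d, hd, hdx⟩ := exists_norm_sub_lt_of_mem_closure_convexHull_union
    (C := convexHull ℝ D) (D := {z ∈ closure (convexHull ℝ A) | f z ≤ s}) (f := f)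
    (convex_convexHull ℝ D) hDne.convexHull hsM
    (fun z hz => forall_mem_closure_convexHull_le hx.le z
      (subset_closure (convexHull_mono hDA hz))) (fun z hz => hz.2)
    (((convexHull_mono hDA).trans subset_closure).trans hK1) ((sep_subset _ _).trans hK1)
    (closure_mono (convexHull_mono (union_subset_union_left _ (subset_convexHull ℝ D)))
      (hcover hx.mem)) (t := η) (by
        rw [div_lt_iff₀ (sub_pos.2 hsM)]
        nlinarith [hx.sub_lt])
  rw [convexHull_eq_union_convexHull_finite_subsets] at hd
  obtain ⟨t, ht, hdt⟩ := mem_iUnion₂.1 hd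
  exact ⟨t, t.finite_toSet, ⟨d, hdt, hdx⟩, fun a ha => ht ha⟩

/-- A subset of a closed convex set is weakly closed and weakly discrete as soon as each point of the
convex set has a basic weak neighbourhood containing finitely many points of the subset. -/
theorem weaklyClosed_and_weaklyDiscrete_of_finite {K S : Set X} (hK : Convex ℝ K)
    (hKc : IsClosed K) (hSK : S ⊆ K)
    (h : ∀ c ∈ K, ∃ I : Set ((X →L[ℝ] ℝ) × ℝ), I.Finite ∧ (∀ q ∈ I, q.1 c < q.2) ∧
      {z ∈ S | ∀ q ∈ I, q.1 z < q.2}.Finite) : WeaklyClosed S ∧ WeaklyDiscrete S := by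
  suffices hnhds : ∀ c : WeakSpace ℝ X, ∃ V : Set (WeakSpace ℝ X), IsOpen V ∧ c ∈ V ∧
      (V ∩ toWeakSpace ℝ X '' S).Finite by
    have key : IsClosed (toWeakSpace ℝ X '' S) ∧ IsDiscrete (toWeakSpace ℝ X '' S) := by
      refine isClosed_and_discrete_iff.2 fun c => ?_
      obtain ⟨V, hV, hcV, hfin⟩ := hnhds c
      rw [Filter.disjoint_principal_right]
      have hfin' : IsClosed ((V ∩ toWeakSpace ℝ X '' S) \ {c}) := hfin.sdiff.isClosed
      filter_upwards [mem_nhdsWithin_of_mem_nhds (hV.mem_nhds hcV), self_mem_nhdsWithin,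
        mem_nhdsWithin_of_mem_nhds (hfin'.isOpen_compl.mem_nhds (by simp : c ∈ _))]
        with w hwV hwc hw hwS
      exact hw ⟨⟨hwV, hwS⟩, hwc⟩
    exact ⟨key.1, key.2.to_subtype⟩
  intro c'
  obtain ⟨c, rfl⟩ := (toWeakSpace ℝ X).surjective c'
  by_cases hc : c ∈ K
  · obtain ⟨I, hI, hcI, hfin⟩ := h c hc
    have hopen : ∀ q : (X →L[ℝ] ℝ) × ℝ,
        IsOpen {w : WeakSpace ℝ X | q.1 ((toWeakSpace ℝ X).symm w) < q.2} := fun q =>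
      isOpen_lt (WeakBilin.eval_continuous (topDualPairing ℝ X).flip q.1) continuous_const
    refine ⟨⋂ q ∈ I, {w : WeakSpace ℝ X | q.1 ((toWeakSpace ℝ X).symm w) < q.2},
      hI.isOpen_biInter fun q _ => hopen q, by simpa using hcI,
      (hfin.image (toWeakSpace ℝ X)).subset ?_⟩
    rintro _ ⟨hz, z, hzS, rfl⟩
    exact ⟨z, ⟨hzS, by simpa using hz⟩, rfl⟩
  · have hclosed : IsClosed (toWeakSpace ℝ X '' K) := by
      rw [← hKc.closure_eq, hK.toWeakSpace_closure ℝ]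
      exact isClosed_closure
    refine ⟨(toWeakSpace ℝ X '' K)ᶜ, hclosed.isOpen_compl, by simpa using hc, ?_⟩
    convert finite_empty
    exact disjoint_iff_inter_eq_empty.1 (disjoint_compl_left.mono_right (image_mono hSK))

/-- Construction of a labelled finitely branching tree from a rule producing finite sets of
children. -/
theorem exists_labelled_tree {α : Type*} {P : ℕ → α → Prop} {R : ℕ → α → α → Prop}
    {Q : ℕ → α → Set α → Prop} {a₀ : α} (h₀ : P 0 a₀)
    (h : ∀ n a, P n a → ∃ t : Set α, t.Finite ∧ (∀ b ∈ t, P (n + 1) b ∧ R n a b) ∧ Q n a t) :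
    ∃ (T : Set (List ℕ)) (v : List ℕ → α), IsTree T ∧ FinitelyBranching T ∧
      (∀ b ∈ T, P b.length (v b)) ∧
      (∀ b ∈ T, ∀ i, b ++ [i] ∈ T → R b.length (v b) (v (b ++ [i]))) ∧
      ∀ b ∈ T, Q b.length (v b) {w | ∃ i, b ++ [i] ∈ T ∧ w = v (b ++ [i])} := by
  have h' : ∀ n a, ∃ l : List α, P n a →
      (∀ b ∈ l, P (n + 1) b ∧ R n a b) ∧ Q n a {b | b ∈ l} := by
    intro n a
    by_cases ha : P n a
    · obtain ⟨t, ht, h1, h2⟩ := h n a ha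
      refine ⟨ht.toFinset.toList, fun _ => ⟨by simpa using h1, by simpa using h2⟩⟩
    · exact ⟨[], fun h => absurd h ha⟩
  choose l hl using h'
  let node : List ℕ → Option α := fun b =>
    List.rec (some a₀) (fun i b o => o.bind fun a => (l b.length a)[i]?) b
  have hnil : node [] = some a₀ := rfl
  have hcons : ∀ i b, node (i :: b) = (node b).bind fun a => (l b.length a)[i]? :=
    fun _ _ => rfl
  have hP : ∀ b a, node b = some a → P b.length a := by
    intro b
    induction b with
    | nil => rintro a ha; rw [hnil] at ha; cases ha; exact h₀
    | cons i b ih =>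
      intro a ha
      rw [hcons, Option.bind_eq_some_iff] at ha
      obtain ⟨c, hc, hca⟩ := ha
      exact ((hl _ _ (ih c hc)).1 a (List.mem_of_getElem? hca)).1
  have hmem : ∀ b : List ℕ, (∃ a, node b.reverse = some a) →
      node b.reverse = some ((node b.reverse).getD a₀) := by
    rintro b ⟨a, ha⟩
    simp [ha]
  have happ : ∀ (b : List ℕ) i a, node b.reverse = some a →
      node (b ++ [i]).reverse = (l b.length a)[i]? := by
    intro b i a ha
    rw [List.reverse_append, List.reverse_singleton, List.singleton_append, hcons, ha,
      List.length_reverse]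
    rfl
  refine ⟨{b | ∃ a, node b.reverse = some a}, fun b => (node b.reverse).getD a₀,
    ⟨⟨[], a₀, hnil⟩, ?_⟩, ?_, ?_, ?_, ?_⟩
  · rintro b i ⟨a, ha⟩
    rw [List.reverse_append, List.reverse_singleton, List.singleton_append, hcons,
      Option.bind_eq_some_iff] at ha
    obtain ⟨c, hc, -⟩ := ha
    exact ⟨c, hc⟩
  · rintro b ⟨a, ha⟩
    refine (finite_lt_nat (l b.length a).length).subset ?_
    rintro i ⟨c, hc⟩
    rw [happ b i a ha] at hc
    exact (List.getElem?_eq_some_iff.1 hc).1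
  · intro b hb
    simpa using hP _ _ (hmem b hb)
  · intro b hb i hbi
    have hb' := hmem b hb
    have hbi' := hmem _ hbi
    nth_rewrite 1 [happ b i _ hb'] at hbi'
    have hPb := hP _ _ hb'
    rw [List.length_reverse] at hPb
    exact ((hl _ _ hPb).1 _ (List.mem_of_getElem? hbi')).2
  · intro b hb
    have hb' := hmem b hb
    have hPb := hP _ _ hb'
    rw [List.length_reverse] at hPb
    convert (hl _ _ hPb).2 using 1
    ext w
    constructor
    · rintro ⟨i, hbi, rfl⟩
      have hbi' := hmem _ hbi
      nth_rewrite 1 [happ b i _ hb'] at hbi'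
      exact List.mem_of_getElem? hbi'
    · intro hw
      obtain ⟨i, hi⟩ := List.mem_iff_getElem?.1 hw
      rw [← happ b i _ hb'] at hi
      exact ⟨i, ⟨w, hi⟩, by simp only [hi, Option.getD_some]⟩

theorem IsTree.mem_of_append_mem {T : Set (List ℕ)} (hT : IsTree T) {b : List ℕ} (e : List ℕ)
    (h : b ++ e ∈ T) : b ∈ T := by
  induction e using List.reverseRecOn with
  | nil => simpa using h
  | append_singleton e i ih => exact ih (hT.2 _ i (by simpa using h))

theorem FinitelyBranching.finite_level {T : Set (List ℕ)} (hT : IsTree T)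
    (hfin : FinitelyBranching T) (n : ℕ) : {b ∈ T | b.length = n}.Finite := by
  induction n with
  | zero => exact (finite_singleton []).subset fun b hb => List.length_eq_zero_iff.1 hb.2
  | succ n ih =>
    refine (ih.biUnion fun b hb => (hfin b hb.1).image fun i => b ++ [i]).subset ?_
    rintro b ⟨hb, hbn⟩
    obtain rfl | ⟨c, i, rfl⟩ := List.eq_nil_or_concat' b
    · simp at hbn
    exact mem_biUnion (x := c) ⟨hT.2 c i hb, by simpa using hbn⟩ ⟨i, hb, rfl⟩

/-- The closed convex hull of a separable set is covered by the balls of a given radius around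
countably many points. -/
theorem exists_seq_dist_lt_of_isSeparable {A : Set X} (hA : TopologicalSpace.IsSeparable A)
    (hne : A.Nonempty) {r : ℝ} (hr : 0 < r) :
    ∃ c : ℕ → X, ∀ z ∈ closure (convexHull ℝ A), ∃ k, dist z (c k) < r := by
  have hsep : TopologicalSpace.IsSeparable (closure (convexHull ℝ A)) :=
    ((hA.span (R := ℝ)).mono
      (convexHull_min Submodule.subset_span (Submodule.span ℝ A).convex)).closure
  obtain ⟨s, hs, hsub⟩ := hsep
  obtain ⟨a, ha⟩ := hne
  have hsne : s.Nonempty :=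
    closure_nonempty_iff.1 ⟨a, hsub (subset_closure (subset_convexHull ℝ A ha))⟩
  obtain ⟨c, rfl⟩ := hs.exists_eq_range hsne
  exact ⟨c, fun z hz => Metric.mem_closure_range_iff.1 (hsub hz) r hr⟩

theorem statement10 [CompleteSpace X] (A : Set X)
    (hA1 : A ⊆ Metric.closedBall (0 : X) 1) (hAne : A.Nonempty)
    (hAsep : TopologicalSpace.IsSeparable A)
    (ε : ℝ) (hε : 0 < ε) (hAnd : ¬ EpsDentable ε A)
    (δ : ℝ) (hδ : δ < ε / 2) (δseq : ℕ → ℝ) (hδseq : ∀ n, 0 < δseq n) :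
    ∃ (T : Set (List ℕ)) (x : List ℕ → X),
      IsTree T ∧ FinitelyBranching T ∧
      -- the bush lies in `A`
      (∀ b ∈ T, x b ∈ A) ∧
      -- `(x_b)` is a `(δₙ)`-approximate bush
      (∀ b ∈ T, x b ∈ convexHull ℝ {z | ∃ i : ℕ, b ++ [i] ∈ T ∧ z = x (b ++ [i])}
        + Metric.ball (0 : X) (δseq b.length)) ∧
      -- `(x_b)` is `δ`-separated
      (∀ b ∈ T, ∀ i : ℕ, b ++ [i] ∈ T → δ < ‖x b - x (b ++ [i])‖) ∧
      -- any uniformly close family in the closed convex hull is weakly closed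
      -- and weakly discrete
      (∀ (y : List ℕ → X) (γ : ℕ → ℝ),
        (∀ b ∈ T, y b ∈ closure (convexHull ℝ A)) →
        Filter.Tendsto γ Filter.atTop (nhds 0) →
        (∀ b ∈ T, ‖y b - x b‖ < γ b.length) →
        WeaklyClosed {z | ∃ b ∈ T, z = y b} ∧
          WeaklyDiscrete {z | ∃ b ∈ T, z = y b}) ∧
      -- in particular the bush itself is weakly closed and weakly discrete
      WeaklyClosed {z | ∃ b ∈ T, z = x b} ∧
      WeaklyDiscrete {z | ∃ b ∈ T, z = x b} := by
  obtain ⟨r, hrmax, hrε⟩ : ∃ r, max δ 0 < r ∧ r < ε / 2 :=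
    exists_between (max_lt hδ (half_pos hε))
  obtain ⟨hδr, hr⟩ := max_lt_iff.1 hrmax
  have hAK : A ⊆ closure (convexHull ℝ A) := (subset_convexHull ℝ A).trans subset_closure
  obtain ⟨c, hc⟩ := exists_seq_dist_lt_of_isSeparable hAsep hAne hr
  obtain ⟨a₀, ha₀⟩ := hAne
  obtain ⟨T, v, hT, hfin, hP, hR, hQ⟩ := exists_labelled_tree
    (α := X × (X →L[ℝ] ℝ) × ℝ × ℝ) (a₀ := (a₀, 0, -1, 0))
    (P := fun n w => IsDeepPoint A (δseq n / 2) w.1 w.2.1 w.2.2.1 w.2.2.2)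
    (R := fun n w w' => r < ‖w.1 - w'.1‖ ∧
      (∀ z ∈ closure (convexHull ℝ A), w.2.1 z ≤ w.2.2.1 → w'.2.1 z < w'.2.2.1) ∧
      ∀ z ∈ closure (convexHull ℝ A), z ∈ closedBall (c n) r → w'.2.1 z < w'.2.2.1)
    (Q := fun n w t => ∃ d ∈ convexHull ℝ (Prod.fst '' t), ‖w.1 - d‖ < δseq n)
    (by
      refine ⟨ha₀, by simp, by simp, ?_⟩
      simpa using hδseq 0)
    (by
      classical
      intro n w hw
      obtain ⟨t, ht, ⟨d, hd, hdw⟩, hta⟩ := exists_finite_deepPoints hAnd hA1 hr.le hrε hw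
        (mul_div_cancel₀ (δseq n) two_ne_zero).le (half_pos (hδseq (n + 1))) {w.1, c n}
      choose! g u N hdeep hnest hball using hta
      refine ⟨(fun a => (a, g a, u a, N a)) '' t, ht.image _, ?_, d, ?_, hdw⟩
      · rintro _ ⟨a, ha, rfl⟩
        refine ⟨hdeep a ha, ?_, hnest a ha, hball a ha (c n) (by simp)⟩
        by_contra! hle
        refine (hball a ha w.1 (by simp) a (hAK (hdeep a ha).mem) ?_).not_gt (hdeep a ha).lt
        rwa [mem_closedBall, dist_comm, dist_eq_norm]
      · simpa [image_image] using hd)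
  have hlocal : ∀ (y : List ℕ → X) (γ : ℕ → ℝ),
      (∀ b ∈ T, y b ∈ closure (convexHull ℝ A)) → Filter.Tendsto γ Filter.atTop (nhds 0) →
      (∀ b ∈ T, ‖y b - (v b).1‖ < γ b.length) →
      WeaklyClosed {z | ∃ b ∈ T, z = y b} ∧ WeaklyDiscrete {z | ∃ b ∈ T, z = y b} := by
    intro y γ hy hγ hyγ
    refine weaklyClosed_and_weaklyDiscrete_of_finite (convex_convexHull ℝ A).closure
      isClosed_closure (by rintro _ ⟨b, hb, rfl⟩; exact hy b hb) fun z hz => ?_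
    obtain ⟨k, hk⟩ := hc z hz
    have hlevel := hfin.finite_level hT (k + 1)
    have hzlt : ∀ b ∈ T, b.length = k + 1 → (v b).2.1 z < (v b).2.2.1 := by
      intro b hb hbk
      obtain rfl | ⟨e, i, rfl⟩ := List.eq_nil_or_concat' b
      · simp at hbk
      · have hek : e.length = k := by simpa using hbk
        exact (hR e (hT.2 e i hb) i hb).2.2 z hz (by rw [hek]; exact hk.le)
    have hnested : ∀ b e, b ++ e ∈ T → ∀ w ∈ closure (convexHull ℝ A),
        (v (b ++ e)).2.2.1 < (v (b ++ e)).2.1 w → (v b).2.2.1 < (v b).2.1 w := by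
      intro b e
      induction e using List.reverseRecOn with
      | nil => simp
      | append_singleton e i ih =>
        intro hbe w hw hlt
        rw [← List.append_assoc] at hbe hlt
        refine ih (hT.2 _ i hbe) w hw ?_
        by_contra! hle
        exact ((hR _ (hT.2 _ i hbe) i hbe).2.1 w hw hle).not_gt hlt
    have hclose : ∀ᶠ n in Filter.atTop, ∀ b ∈ {b ∈ T | b.length = k + 1},
        ‖(v b).2.1‖ * γ n < ((v b).2.2.1 - (v b).2.1 z) / 2 := by
      rw [Filter.eventually_all_finite hlevel]
      rintro b ⟨hb, hbk⟩
      have hlim := hγ.const_mul ‖(v b).2.1‖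
      rw [mul_zero] at hlim
      exact hlim.eventually_lt_const (half_pos (sub_pos.2 (hzlt b hb hbk)))
    obtain ⟨n₀, hn₀⟩ := Filter.eventually_atTop.1 hclose
    refine ⟨(fun b => ((v b).2.1, ((v b).2.1 z + (v b).2.2.1) / 2)) ''
      {b ∈ T | b.length = k + 1}, hlevel.image _, ?_, ?_⟩
    · rintro _ ⟨b, ⟨hb, hbk⟩, rfl⟩
      have := hzlt b hb hbk
      dsimp only
      linarith
    · refine (((finite_lt_nat (max n₀ (k + 1))).biUnion fun n _ =>
        hfin.finite_level hT n).image y).subset ?_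
      rintro _ ⟨⟨b, hb, rfl⟩, hbI⟩
      refine ⟨b, mem_biUnion (x := b.length) ?_ ⟨hb, rfl⟩, rfl⟩
      rw [mem_ofPred_eq]
      by_contra! hlen
      obtain ⟨hn, hkb⟩ := max_le_iff.1 hlen
      have hbk : b.take (k + 1) ++ b.drop (k + 1) ∈ T := by rwa [List.take_append_drop]
      have haT := hT.mem_of_append_mem _ hbk
      have hal : (b.take (k + 1)).length = k + 1 := by simpa using hkb
      have hx := hnested _ _ hbk (v b).1 (hAK (hP b hb).mem) (by
        rw [List.take_append_drop]
        exact (hP b hb).lt)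
      have hlt := hbI _ ⟨_, ⟨haT, hal⟩, rfl⟩
      have hγb := hn₀ _ hn _ ⟨haT, hal⟩
      set f := (v (b.take (k + 1))).2.1
      have hf : f (v b).1 - f (y b) ≤ ‖f‖ * γ b.length := by
        calc f (v b).1 - f (y b) = f ((v b).1 - y b) := (map_sub f _ _).symm
          _ ≤ ‖f ((v b).1 - y b)‖ := le_abs_self _
          _ ≤ ‖f‖ * ‖(v b).1 - y b‖ := f.le_opNorm _
          _ ≤ ‖f‖ * γ b.length := by
            rw [norm_sub_rev]
            gcongr
            exact (hyγ b hb).le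
      dsimp only at hlt
      linarith
  refine ⟨T, fun b => (v b).1, hT, hfin, fun b hb => (hP b hb).mem, fun b hb => ?_,
    fun b hb i hbi => hδr.trans (hR b hb i hbi).1, hlocal,
    hlocal _ (fun n => 1 / ((n : ℝ) + 1)) (fun b hb => hAK (hP b hb).mem)
      tendsto_one_div_add_atTop_nhds_zero_nat fun b _ => ?_⟩
  · obtain ⟨d, hd, hdb⟩ := hQ b hb
    refine ⟨d, convexHull_mono ?_ hd, (v b).1 - d, mem_ball_zero_iff.2 hdb,
      add_sub_cancel d (v b).1⟩
    rintro _ ⟨_, ⟨i, hbi, rfl⟩, rfl⟩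
    exact ⟨i, hbi, rfl⟩
  · rw [sub_self, norm_zero]
    positivity
end
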